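/- arXiv:1508.00980 — 2 statements merged into one kernel-verified Lean document; each statement's English description precedes it below -/
import Mathlib

section
/- Let G be a discrete group and let L be a length function on G with bounded doubling. For every ε > 0 there exists a finite subset S_ε ⊆ G such that for every finitely supported f : G → ℂ satisfying ‖[D, λ_f]‖ ≤ 1 there exists a decomposition f = f♯ + f♭ where f♭ is supported in S_ε and ‖λ_{f♯}‖ ≤ ε. -/
open scoped ENNReal ComplexConjugate

noncomputable section

variable {G : Type*}

/-- The Hilbert space `ℓ²(G)` of square-summable complex-valued functions on `G`. -/
abbrev l2 (G : Type*) : Type _ := lp (fun _ : G => ℂ) 2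

variable [Group G]

/-- A length function on a group `G`: subadditive, symmetric under inverses,
and vanishing exactly at the identity. -/
structure IsLengthFunction (L : G → ℝ) : Prop where
  nonneg : ∀ x, 0 ≤ L x
  subadd : ∀ x y, L (x * y) ≤ L x + L y
  inv_eq : ∀ x, L x⁻¹ = L x
  eq_zero_iff : ∀ x, L x = 0 ↔ x = 1

/-- The ball `B(r) = {x ∈ G : L x ≤ r}`. -/
def lball (L : G → ℝ) (r : ℝ) : Set G := {x : G | L x ≤ r}

/-- A length function is proper if all balls are finite. -/
def IsProperLF (L : G → ℝ) : Prop := ∀ r : ℝ, (lball L r).Finite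

/-- Bounded doubling: `L` is proper and there is `C < ∞` with
`|B(2r)| ≤ C |B(r)|` for all `r ≥ 1`. -/
def HasBoundedDoubling (L : G → ℝ) : Prop :=
  IsProperLF L ∧ ∃ C : ℝ, ∀ r : ℝ, 1 ≤ r →
    ((lball L (2 * r)).ncard : ℝ) ≤ C * ((lball L r).ncard : ℝ)

/-- `T` is the convolution operator `λ_f`, `(λ_f ξ)(x) = Σ_y f(xy⁻¹) ξ(y)`. -/
def IsConvOp (f : G → ℂ) (T : l2 G →L[ℂ] l2 G) : Prop :=
  ∀ (ξ : l2 G) (x : G), T ξ x = ∑' y : G, f (x * y⁻¹) * ξ y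

/-- `T` is the commutator `[D, λ_f]` for `D = M_L`, i.e.
`([D,λ_f] ξ)(x) = Σ_y (L x − L y) f(xy⁻¹) ξ(y)`. -/
def IsCommOp (L : G → ℝ) (f : G → ℂ) (T : l2 G →L[ℂ] l2 G) : Prop :=
  ∀ (ξ : l2 G) (x : G), T ξ x = ∑' y : G, ((L x : ℂ) - (L y : ℂ)) * f (x * y⁻¹) * ξ y

/-- `T` is the truncated operator `(I − M_{2r}) λ_f M_r`. -/
def IsTruncOp (L : G → ℝ) (f : G → ℂ) (r : ℝ) (T : l2 G →L[ℂ] l2 G) : Prop :=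
  ∀ (ξ : l2 G) (x : G),
    T ξ x = if L x ≤ 2 * r then 0
      else ∑' y : G, (if L y ≤ r then f (x * y⁻¹) * ξ y else 0)

/-- The seminorm `J_D(f) = sup_{r>0} r ‖(I − M_{2r}) λ_f M_r‖`. -/
def JD (L : G → ℝ) (f : G → ℂ) : ℝ :=
  sSup {a : ℝ | ∃ r : ℝ, 0 < r ∧ ∃ T : l2 G →L[ℂ] l2 G, IsTruncOp L f r T ∧ a = r * ‖T‖}

/-- The convolution `h* ∗ k`, where `h*(z) = conj (h z⁻¹)`. -/
def starConv (h k : G → ℂ) : G → ℂ :=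
  fun x => ∑' z : G, conj (h z⁻¹) * k (z⁻¹ * x)

/-- The `ℓ²` norm `‖h‖₂ = (Σ_x |h x|²)^{1/2}` of a function `h : G → ℂ`. -/
def l2norm (h : G → ℂ) : ℝ := Real.sqrt (∑' x : G, ‖h x‖ ^ 2)

/-- The bilinear form with kernel `A` on finitely supported vectors is bounded by `c` with respect
to the `ℓ²` norms. -/
def KernelBound {α β : Type*} (A : α → β → ℂ) (c : ℝ) : Prop :=
  ∀ (s : Finset α) (t : Finset β) (η : α → ℂ) (ξ : β → ℂ),
    ‖∑ x ∈ s, ∑ y ∈ t, η x * A x y * ξ y‖ ≤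
      c * (√(∑ x ∈ s, ‖η x‖ ^ 2) * √(∑ y ∈ t, ‖ξ y‖ ^ 2))

theorem sqrt_sum_norm_mul_sq_le {γ : Type*} (s : Finset γ) (η p : γ → ℂ) {a : ℝ}
    (ha : 0 ≤ a) (hp : ∀ x, ‖p x‖ ≤ a) :
    √(∑ x ∈ s, ‖η x * p x‖ ^ 2) ≤ a * √(∑ x ∈ s, ‖η x‖ ^ 2) := by
  rw [← Real.sqrt_sq ha, ← Real.sqrt_mul (sq_nonneg _), Finset.mul_sum]
  refine Real.sqrt_le_sqrt (Finset.sum_le_sum fun x _ => ?_)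
  rw [norm_mul, mul_pow, mul_comm]
  have := hp x
  gcongr

namespace KernelBound

variable {α β : Type*} {A B : α → β → ℂ} {c d : ℝ}

theorem sub (hA : KernelBound A c) (hB : KernelBound B d) :
    KernelBound (fun x y => A x y - B x y) (c + d) := by
  intro s t η ξ
  have h : ∑ x ∈ s, ∑ y ∈ t, η x * (A x y - B x y) * ξ y =
      (∑ x ∈ s, ∑ y ∈ t, η x * A x y * ξ y) - ∑ x ∈ s, ∑ y ∈ t, η x * B x y * ξ y := by
    simp only [← Finset.sum_sub_distrib]
    exact Finset.sum_congr rfl fun x _ => Finset.sum_congr rfl fun y _ => by ring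
  rw [h, add_mul]
  exact (norm_sub_le _ _).trans (add_le_add (hA s t η ξ) (hB s t η ξ))

theorem hasSum {ι : Type*} {A : ι → α → β → ℂ} {c : ι → ℝ} {B : α → β → ℂ} {d : ℝ}
    (hA : ∀ i, KernelBound (A i) (c i)) (hc : HasSum c d)
    (hB : ∀ x y, HasSum (fun i => A i x y) (B x y)) : KernelBound B d := by
  intro s t η ξ
  have h : HasSum (fun i => ∑ x ∈ s, ∑ y ∈ t, η x * A i x y * ξ y)
      (∑ x ∈ s, ∑ y ∈ t, η x * B x y * ξ y) :=
    hasSum_sum fun x _ => hasSum_sum fun y _ => ((hB x y).mul_left _).mul_right _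
  rw [← h.tsum_eq]
  exact tsum_of_norm_bounded (hc.mul_right _) fun i => hA i s t η ξ

theorem finsetSum {ι : Type*} {A : ι → α → β → ℂ} {c : ι → ℝ} (I : Finset ι)
    (hA : ∀ i ∈ I, KernelBound (A i) (c i)) :
    KernelBound (fun x y => ∑ i ∈ I, A i x y) (∑ i ∈ I, c i) := by
  have h := hasSum (ι := I) (A := fun i => A i) (c := fun i => c i) (fun i => hA i i.2)
    (hasSum_fintype _) (fun x y => hasSum_fintype _)
  simp only [← Finset.sum_coe_sort I]
  exact h

theorem mono (hA : KernelBound A c) (hcd : c ≤ d) : KernelBound A d := fun s t η ξ =>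
  (hA s t η ξ).trans (mul_le_mul_of_nonneg_right hcd (by positivity))

/-- Multiplication by diagonal operators on both sides. -/
theorem weights (hA : KernelBound A c) (hc : 0 ≤ c) {p : α → ℂ} {q : β → ℂ} {a b : ℝ}
    (ha : 0 ≤ a) (hb : 0 ≤ b) (hp : ∀ x, ‖p x‖ ≤ a) (hq : ∀ y, ‖q y‖ ≤ b) :
    KernelBound (fun x y => p x * A x y * q y) (c * (a * b)) := by
  intro s t η ξ
  have h := hA s t (fun x => η x * p x) (fun y => ξ y * q y)
  calc ‖∑ x ∈ s, ∑ y ∈ t, η x * (p x * A x y * q y) * ξ y‖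
      = ‖∑ x ∈ s, ∑ y ∈ t, η x * p x * A x y * (ξ y * q y)‖ := by
        congr 1
        exact Finset.sum_congr rfl fun x _ => Finset.sum_congr rfl fun y _ => by ring
    _ ≤ c * (√(∑ x ∈ s, ‖η x * p x‖ ^ 2) * √(∑ y ∈ t, ‖ξ y * q y‖ ^ 2)) := h
    _ ≤ c * ((a * √(∑ x ∈ s, ‖η x‖ ^ 2)) * (b * √(∑ y ∈ t, ‖ξ y‖ ^ 2))) := by
        gcongr
        · exact sqrt_sum_norm_mul_sq_le s η p ha hp
        · exact sqrt_sum_norm_mul_sq_le t ξ q hb hq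
    _ = _ := by ring

theorem comp_equiv {α' β' : Type*} (hA : KernelBound A c) (e : α' ≃ α) (e' : β' ≃ β) :
    KernelBound (fun x y => A (e x) (e' y)) c := by
  intro s t η ξ
  simpa using hA (s.map e.toEmbedding) (t.map e'.toEmbedding) (η ∘ e.symm) (ξ ∘ e'.symm)

/-- Solving the commutator equation on spectrally separated blocks: the expansion
`1 / (a - b) = ∑ bⁿ / aⁿ⁺¹` costs a factor `1 / r` when `a ≥ 2r` and `0 ≤ b ≤ r`. -/
theorem of_separated {a : α → ℝ} {b : β → ℝ} {r : ℝ} (hr : 0 < r) (hc : 0 ≤ c)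
    (hA : KernelBound (fun x y => ((a x : ℂ) - (b y : ℂ)) * A x y) c)
    {p : α → ℂ} {q : β → ℂ} (hp : ∀ x, ‖p x‖ ≤ 1) (hq : ∀ y, ‖q y‖ ≤ 1)
    (hpa : ∀ x, p x ≠ 0 → 2 * r ≤ a x) (hqb : ∀ y, q y ≠ 0 → 0 ≤ b y ∧ b y ≤ r) :
    KernelBound (fun x y => p x * A x y * q y) (c / r) := by
  refine hasSum (ι := ℕ)
    (A := fun n x y => (p x * ((a x : ℂ)⁻¹) ^ (n + 1)) *
      (((a x : ℂ) - (b y : ℂ)) * A x y) * (q y * (b y : ℂ) ^ n))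
    (c := fun n => c * (((2 * r)⁻¹) ^ (n + 1) * r ^ n)) (fun n => ?_) ?_ ?_
  · refine hA.weights hc (by positivity) (by positivity) (fun x => ?_) (fun y => ?_)
    · by_cases h : p x = 0
      · rw [h, zero_mul, norm_zero]; positivity
      · have h2 := hpa x h
        have h0 : 0 < a x := by linarith
        rw [norm_mul, norm_pow, norm_inv, Complex.norm_real, Real.norm_of_nonneg h0.le]
        calc _ ≤ 1 * ((2 * r)⁻¹) ^ (n + 1) := by gcongr; exact hp x
          _ = _ := one_mul _
    · by_cases h : q y = 0
      · rw [h, zero_mul, norm_zero]; positivity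
      · obtain ⟨h0, h1⟩ := hqb y h
        rw [norm_mul, norm_pow, Complex.norm_real, Real.norm_of_nonneg h0]
        calc _ ≤ 1 * r ^ n := by gcongr; exact hq y
          _ = _ := one_mul _
  · have h := (hasSum_geometric_two).mul_left (c * (2 * r)⁻¹)
    rw [show c * (2 * r)⁻¹ * 2 = c / r by field_simp] at h
    refine (congrArg (HasSum · _) (funext fun n => ?_)).mpr h
    rw [pow_succ, mul_inv, mul_pow, inv_pow, inv_pow, one_div, inv_pow]
    field_simp
  · intro x y
    by_cases hx : p x = 0
    · simp [hx]
    by_cases hy : q y = 0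
    · simp [hy]
    have h2 := hpa x hx
    obtain ⟨h0, h1⟩ := hqb y hy
    have ha : 0 < a x := by linarith
    have hab : 0 < a x - b y := by linarith
    have hlt : ‖(b y : ℂ) * (a x : ℂ)⁻¹‖ < 1 := by
      rw [norm_mul, norm_inv, Complex.norm_real, Complex.norm_real, Real.norm_of_nonneg h0,
        Real.norm_of_nonneg ha.le, ← div_eq_mul_inv, div_lt_one ha]
      linarith
    have haC : (a x : ℂ) ≠ 0 := by exact_mod_cast ha.ne'
    have habC : (a x : ℂ) - b y ≠ 0 := by exact_mod_cast hab.ne'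
    have h := (hasSum_geometric_of_norm_lt_one hlt).mul_left
      (p x * (a x : ℂ)⁻¹ * (((a x : ℂ) - (b y : ℂ)) * A x y) * q y)
    have hval : p x * (a x : ℂ)⁻¹ * (((a x : ℂ) - (b y : ℂ)) * A x y) * q y *
        (1 - (b y : ℂ) * (a x : ℂ)⁻¹)⁻¹ = p x * A x y * q y := by
      rw [show 1 - (b y : ℂ) * (a x : ℂ)⁻¹ = ((a x : ℂ) - b y) * (a x : ℂ)⁻¹ by field_simp]
      field_simp
    rw [hval] at h
    refine (congrArg (HasSum · _) (funext fun n => ?_)).mpr h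
    rw [mul_pow]
    ring

end KernelBound

/-- The average over `v ∈ F` of the indicator function of `E` at `v * g⁻¹`; up to normalization
this is `1_E* ∗ 1_F`. -/
def avgMult (E F : Finset G) (g : G) : ℂ :=
  open Classical in (F.card : ℂ)⁻¹ * ∑ v ∈ F, if v * g⁻¹ ∈ E then 1 else 0

open Classical in
/-- Schur multiplication by `avgMult E F`, controlled through the blocks
`1_E(u x⁻¹) A(x, y) 1_F(u y⁻¹)`. -/
theorem KernelBound.mul_avgMult {A : G → G → ℂ} {c : ℝ} (hc : 0 ≤ c) (E F : Finset G)
    (hF : F.Nonempty)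
    (hA : ∀ u : G, KernelBound (fun x y => (if u * x⁻¹ ∈ E then 1 else 0) * A x y *
      (if u * y⁻¹ ∈ F then 1 else 0)) c) :
    KernelBound (fun x y => A x y * avgMult E F (x * y⁻¹)) (c * √((E.card : ℝ) / F.card)) := by
  intro s t η ξ
  set U : Finset G := (F ×ˢ t).image fun w => w.1 * w.2
  have hcard : (0 : ℝ) < F.card := by exact_mod_cast hF.card_pos
  have hcardC : (F.card : ℂ) ≠ 0 := by exact_mod_cast hcard.ne'
  have havg : ∀ x, ∀ y ∈ t, (F.card : ℂ) * avgMult E F (x * y⁻¹) =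
      ∑ u ∈ U, (if u * x⁻¹ ∈ E then (1 : ℂ) else 0) * (if u * y⁻¹ ∈ F then 1 else 0) := by
    intro x y hy
    rw [avgMult, mul_inv_cancel_left₀ hcardC]
    symm
    simp only [mul_ite, mul_one, mul_zero]
    rw [← Finset.sum_filter]
    refine Finset.sum_bij' (fun u _ => u * y⁻¹) (fun v _ => v * y) ?_ ?_ ?_ ?_ ?_
    · intro u hu
      exact (Finset.mem_filter.1 hu).2
    · intro v hv
      refine Finset.mem_filter.2 ⟨Finset.mem_image.2 ⟨(v, y), by simp [hv, hy], rfl⟩, by simpa⟩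
    · simp
    · simp
    · intro u _
      simp [mul_assoc]
  have hone : ∀ (W V : Finset G) (z : G),
      ∑ u ∈ W, ‖(if u * z⁻¹ ∈ V then (1 : ℂ) else 0)‖ ^ 2 ≤ V.card := by
    intro W V z
    have : ∀ u, ‖(if u * z⁻¹ ∈ V then (1 : ℂ) else 0)‖ ^ 2 =
        if u * z⁻¹ ∈ V then (1 : ℝ) else 0 := by
      intro u; split_ifs <;> simp
    simp only [this]
    rw [← Finset.sum_filter, Finset.sum_const, nsmul_eq_mul, mul_one, Nat.cast_le]
    exact Finset.card_le_card_of_injOn (fun u => u * z⁻¹)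
      (fun u hu => (Finset.mem_filter.1 hu).2) (mul_left_injective _).injOn
  have hvec : ∀ (S V : Finset G) (ζ : G → ℂ),
      ∑ u ∈ U, ∑ z ∈ S, ‖ζ z * (if u * z⁻¹ ∈ V then (1 : ℂ) else 0)‖ ^ 2 ≤
        V.card * ∑ z ∈ S, ‖ζ z‖ ^ 2 := by
    intro S V ζ
    rw [Finset.sum_comm, Finset.mul_sum]
    refine Finset.sum_le_sum fun z _ => ?_
    simp only [norm_mul, mul_pow]
    rw [← Finset.mul_sum, mul_comm]
    exact mul_le_mul_of_nonneg_right (hone U V z) (sq_nonneg _)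
  have hblock : ∀ u ∈ U,
      ‖∑ x ∈ s, ∑ y ∈ t, η x * ((if u * x⁻¹ ∈ E then 1 else 0) * A x y *
        (if u * y⁻¹ ∈ F then 1 else 0)) * ξ y‖ ≤
      c * (√(∑ x ∈ s, ‖η x * (if u * x⁻¹ ∈ E then (1 : ℂ) else 0)‖ ^ 2) *
        √(∑ y ∈ t, ‖ξ y * (if u * y⁻¹ ∈ F then (1 : ℂ) else 0)‖ ^ 2)) := by
    intro u _
    have h := hA u s t (fun x => η x * (if u * x⁻¹ ∈ E then (1 : ℂ) else 0))
      (fun y => ξ y * (if u * y⁻¹ ∈ F then (1 : ℂ) else 0))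
    convert h using 2
    refine Finset.sum_congr rfl fun x _ => Finset.sum_congr rfl fun y _ => ?_
    by_cases hx : u * x⁻¹ ∈ E <;> by_cases hy : u * y⁻¹ ∈ F <;> simp [hx, hy]
  have hmain : (F.card : ℝ) *
      ‖∑ x ∈ s, ∑ y ∈ t, η x * (A x y * avgMult E F (x * y⁻¹)) * ξ y‖ ≤
      c * (√(E.card * ∑ x ∈ s, ‖η x‖ ^ 2) * √(F.card * ∑ y ∈ t, ‖ξ y‖ ^ 2)) := by
    calc (F.card : ℝ) * ‖∑ x ∈ s, ∑ y ∈ t, η x * (A x y * avgMult E F (x * y⁻¹)) * ξ y‖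
        = ‖∑ x ∈ s, ∑ y ∈ t, η x * A x y * ξ y * (F.card * avgMult E F (x * y⁻¹))‖ := by
          rw [← Complex.norm_natCast, ← norm_mul, Finset.mul_sum]
          congr 1
          refine Finset.sum_congr rfl fun x _ => ?_
          rw [Finset.mul_sum]
          exact Finset.sum_congr rfl fun y _ => by ring
      _ = ‖∑ u ∈ U, ∑ x ∈ s, ∑ y ∈ t, η x * ((if u * x⁻¹ ∈ E then 1 else 0) * A x y *
            (if u * y⁻¹ ∈ F then 1 else 0)) * ξ y‖ := by
          congr 1
          rw [Finset.sum_comm (s := U)]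
          refine Finset.sum_congr rfl fun x _ => ?_
          rw [Finset.sum_comm (s := U)]
          refine Finset.sum_congr rfl fun y hy => ?_
          rw [havg x y hy, Finset.mul_sum]
          exact Finset.sum_congr rfl fun u _ => by ring
      _ ≤ ∑ u ∈ U, c * (√(∑ x ∈ s, ‖η x * (if u * x⁻¹ ∈ E then (1 : ℂ) else 0)‖ ^ 2) *
            √(∑ y ∈ t, ‖ξ y * (if u * y⁻¹ ∈ F then (1 : ℂ) else 0)‖ ^ 2)) :=
          norm_sum_le_of_le _ hblock
      _ ≤ _ := by
          rw [← Finset.mul_sum]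
          gcongr
          refine (Real.sum_sqrt_mul_sqrt_le U (fun _ => by positivity)
            (fun _ => by positivity)).trans ?_
          gcongr
          · exact hvec s E η
          · exact hvec t F ξ
  rw [Real.sqrt_mul (by positivity), Real.sqrt_mul (by positivity)] at hmain
  rw [Real.sqrt_div (by positivity)]
  refine le_of_mul_le_mul_left (hmain.trans (le_of_eq ?_)) hcard
  have h1 : √(F.card : ℝ) ≠ 0 := (Real.sqrt_pos.2 hcard).ne'
  nth_rewrite 2 [← Real.mul_self_sqrt hcard.le]
  field_simp

theorem KernelBound.mul_avgMult_of_bound {A : G → G → ℂ} {c : ℝ} (hc : 0 ≤ c) (E F : Finset G)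
    (hF : F.Nonempty) (hA : KernelBound A c) :
    KernelBound (fun x y => A x y * avgMult E F (x * y⁻¹)) (c * √((E.card : ℝ) / F.card)) := by
  classical
  refine KernelBound.mul_avgMult hc E F hF fun u => ?_
  have h : ∀ (V : Finset G) (x : G), ‖(if u * x⁻¹ ∈ V then (1 : ℂ) else 0)‖ ≤ 1 := by
    intro V x; split_ifs <;> simp
  simpa using hA.weights hc zero_le_one zero_le_one (h E) (h F)

/-- If `[D, λ_f]` is bounded by `1`, `E` avoids the ball of radius `2r` and `F` lies in the ball of
radius `r`, then Schur multiplication by `avgMult E F` gains a factor `1 / r`. -/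
theorem KernelBound.mul_avgMult_of_comm {L : G → ℝ} (hL : IsLengthFunction L) {f : G → ℂ}
    (hf : KernelBound (fun x y => ((L x : ℂ) - (L y : ℂ)) * f (x * y⁻¹)) 1)
    {r : ℝ} (hr : 0 < r) (E F : Finset G) (hF : F.Nonempty)
    (hEr : ∀ g ∈ E, 2 * r ≤ L g) (hFr : ∀ g ∈ F, L g ≤ r) :
    KernelBound (fun x y => f (x * y⁻¹) * avgMult E F (x * y⁻¹))
      (1 / r * √((E.card : ℝ) / F.card)) := by
  classical
  refine KernelBound.mul_avgMult (A := fun x y => f (x * y⁻¹)) (by positivity) E F hF fun u => ?_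
  have hLu : ∀ x, L (x * u⁻¹) = L (u * x⁻¹) := by
    intro x
    rw [← hL.inv_eq]
    simp
  have h := hf.comp_equiv (Equiv.mulRight u⁻¹) (Equiv.mulRight u⁻¹)
  simp only [Equiv.coe_mulRight, hLu, mul_inv_rev, inv_inv, inv_mul_cancel_left, mul_assoc] at h
  refine KernelBound.of_separated (a := fun x => L (u * x⁻¹)) (b := fun x => L (u * x⁻¹))
    hr zero_le_one h ?_ ?_ ?_ ?_
  · intro x; split_ifs <;> simp
  · intro x; split_ifs <;> simp
  · intro x hx
    exact hEr _ (by by_contra hn; simp [hn] at hx)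
  · intro x hx
    exact ⟨hL.nonneg _, hFr _ (by by_contra hn; simp [hn] at hx)⟩

theorem avgMult_eq_one {E F : Finset G} (hF : F.Nonempty) {g : G} (h : ∀ v ∈ F, v * g⁻¹ ∈ E) :
    avgMult E F g = 1 := by
  classical
  have hc : (F.card : ℂ) ≠ 0 := by exact_mod_cast hF.card_pos.ne'
  rw [avgMult, Finset.sum_congr rfl fun v hv => if_pos (h v hv)]
  simp [hc]

theorem avgMult_eq_zero {E F : Finset G} {g : G} (h : ∀ v ∈ F, v * g⁻¹ ∉ E) :
    avgMult E F g = 0 := by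
  classical
  rw [avgMult, Finset.sum_congr rfl fun v hv => if_neg (h v hv)]
  simp

theorem sqrt_sum_norm_sq_le {α : Type*} (ξ : l2 α) (s : Finset α) : √(∑ x ∈ s, ‖ξ x‖ ^ 2) ≤ ‖ξ‖ := by
  refine Real.sqrt_le_iff.2 ⟨norm_nonneg _, ?_⟩
  have h := lp.sum_rpow_le_norm_rpow (p := 2) (by norm_num) ξ s
  simpa using h

theorem norm_le_of_sqrt_sum_norm_sq_le {α : Type*} (ξ : l2 α) {C : ℝ} (hC : 0 ≤ C)
    (h : ∀ s : Finset α, √(∑ x ∈ s, ‖ξ x‖ ^ 2) ≤ C) : ‖ξ‖ ≤ C := by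
  refine lp.norm_le_of_forall_sum_le (p := 2) (by norm_num) hC fun s => ?_
  simpa using (Real.sqrt_le_iff.1 (h s)).2

/-- The matrix of a bounded operator satisfies the corresponding kernel bound. -/
theorem kernelBound_of_operator {α : Type*} {A : α → α → ℂ} {T : l2 α →L[ℂ] l2 α}
    (hT : ∀ (ξ : l2 α) (x : α), T ξ x = ∑' y : α, A x y * ξ y) : KernelBound A ‖T‖ := by
  classical
  intro s t η ξ
  obtain ⟨ζ, hζ, hnorm⟩ : ∃ ζ : l2 α, (∀ y, ζ y = if y ∈ t then ξ y else 0) ∧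
      ‖ζ‖ ≤ √(∑ y ∈ t, ‖ξ y‖ ^ 2) := by
    have happ : ∀ y, (∑ z ∈ t, lp.single 2 z (ξ z) : l2 α) y = if y ∈ t then ξ y else 0 := by
      intro y
      rw [lp.coeFn_sum, Finset.sum_apply]
      simp [lp.single_apply, Pi.single_apply]
    refine ⟨∑ z ∈ t, lp.single 2 z (ξ z), happ, ?_⟩
    refine norm_le_of_sqrt_sum_norm_sq_le _ (Real.sqrt_nonneg _) fun S => Real.sqrt_le_sqrt ?_
    have : ∀ y, ‖(∑ z ∈ t, lp.single 2 z (ξ z) : l2 α) y‖ ^ 2 =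
        if y ∈ t then ‖ξ y‖ ^ 2 else 0 := by
      intro y
      rw [happ]
      split_ifs <;> simp
    simp only [this]
    rw [← Finset.sum_filter]
    exact Finset.sum_le_sum_of_subset_of_nonneg
      (fun y hy => (Finset.mem_filter.1 hy).2) (fun _ _ _ => sq_nonneg _)
  have hTζ : ∀ x, T ζ x = ∑ y ∈ t, A x y * ξ y := by
    intro x
    rw [hT, tsum_eq_sum (s := t) (fun y hy => by simp [hζ, hy])]
    exact Finset.sum_congr rfl fun y hy => by simp [hζ, hy]
  calc ‖∑ x ∈ s, ∑ y ∈ t, η x * A x y * ξ y‖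
      = ‖∑ x ∈ s, η x * T ζ x‖ := by
        congr 1
        refine Finset.sum_congr rfl fun x _ => ?_
        rw [hTζ, Finset.mul_sum]
        exact Finset.sum_congr rfl fun y _ => by ring
    _ ≤ ∑ x ∈ s, ‖η x‖ * ‖T ζ x‖ := norm_sum_le_of_le _ fun x _ => (norm_mul _ _).le
    _ ≤ √(∑ x ∈ s, ‖η x‖ ^ 2) * √(∑ x ∈ s, ‖T ζ x‖ ^ 2) :=
        Real.sum_mul_le_sqrt_mul_sqrt _ _ _
    _ ≤ √(∑ x ∈ s, ‖η x‖ ^ 2) * (‖T‖ * √(∑ y ∈ t, ‖ξ y‖ ^ 2)) := by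
        gcongr
        exact (sqrt_sum_norm_sq_le _ _).trans ((T.le_opNorm ζ).trans (by gcongr))
    _ = _ := by ring

theorem IsConvOp.norm_le_of_kernelBound {f : G →₀ ℂ} {c : ℝ} (hc : 0 ≤ c)
    (hf : KernelBound (fun x y => f (x * y⁻¹)) c) {T : l2 G →L[ℂ] l2 G}
    (hT : IsConvOp (f : G → ℂ) T) : ‖T‖ ≤ c := by
  classical
  refine T.opNorm_le_bound hc fun ξ =>
    norm_le_of_sqrt_sum_norm_sq_le _ (by positivity) fun s => ?_
  set t : Finset G := (f.support ×ˢ s).image fun w => w.1⁻¹ * w.2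
  have hTξ : ∀ x ∈ s, T ξ x = ∑ y ∈ t, f (x * y⁻¹) * ξ y := by
    intro x hx
    rw [hT ξ x]
    refine tsum_eq_sum fun y hy => ?_
    have : f (x * y⁻¹) = 0 := by
      by_contra hne
      exact hy (Finset.mem_image.2 ⟨(x * y⁻¹, x), by simp [hx, hne], by simp⟩)
    rw [this, zero_mul]
  have h := hf s t (fun x => conj (T ξ x)) ξ
  have hsum : ∑ x ∈ s, ∑ y ∈ t, conj (T ξ x) * f (x * y⁻¹) * ξ y =
      ((∑ x ∈ s, ‖T ξ x‖ ^ 2 : ℝ) : ℂ) := by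
    push_cast
    refine Finset.sum_congr rfl fun x hx => ?_
    rw [← Complex.conj_mul', hTξ x hx, Finset.mul_sum]
    exact Finset.sum_congr rfl fun y _ => by ring
  have h0 : 0 ≤ ∑ x ∈ s, ‖T ξ x‖ ^ 2 := by positivity
  rw [hsum, Complex.norm_real, Real.norm_of_nonneg h0] at h
  simp only [RCLike.norm_conj] at h
  rcases (Real.sqrt_nonneg (∑ x ∈ s, ‖T ξ x‖ ^ 2)).eq_or_lt with hz | hpos
  · rw [← hz]; positivity
  · refine le_of_mul_le_mul_left ?_ hpos
    rw [Real.mul_self_sqrt h0]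
    refine h.trans ?_
    rw [mul_left_comm]
    gcongr
    exact sqrt_sum_norm_sq_le ξ t

theorem IsLengthFunction.sub_le_mul_inv {L : G → ℝ} (hL : IsLengthFunction L) (v g : G) :
    L g - L v ≤ L (v * g⁻¹) ∧ L (v * g⁻¹) ≤ L g + L v := by
  constructor
  · have h := hL.subadd (v * g⁻¹)⁻¹ v
    rw [hL.inv_eq] at h
    simp only [mul_inv_rev, inv_inv, inv_mul_cancel_right] at h
    linarith
  · have h := hL.subadd v g⁻¹
    rw [hL.inv_eq] at h
    linarith

/-- Bounded doubling provides, at each scale `r ≥ 1`, a function `m` equal to `1` for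
`3r ≤ L ≤ 12r` and to `0` outside `r ≤ L ≤ 14r`, acting boundedly as a Schur multiplier, and with
gain `1 / r` on those `f` for which `[D, λ_f]` is bounded by `1`. -/
theorem exists_annular_multiplier {L : G → ℝ} (hL : IsLengthFunction L)
    (hBD : HasBoundedDoubling L) :
    ∃ M : ℝ, 0 ≤ M ∧ ∀ r : ℝ, 1 ≤ r → ∃ m : G → ℂ,
      (∀ g, 3 * r ≤ L g → L g ≤ 12 * r → m g = 1) ∧
      (∀ g, L g < r ∨ 14 * r < L g → m g = 0) ∧
      (∀ (A : G → G → ℂ) (c : ℝ), 0 ≤ c → KernelBound A c →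
        KernelBound (fun x y => A x y * m (x * y⁻¹)) (c * M)) ∧
      (∀ f : G → ℂ, KernelBound (fun x y => ((L x : ℂ) - (L y : ℂ)) * f (x * y⁻¹)) 1 →
        KernelBound (fun x y => f (x * y⁻¹) * m (x * y⁻¹)) (1 / r * M)) := by
  classical
  obtain ⟨hfin, C, hC⟩ := hBD
  have hmono : ∀ {a b : ℝ}, a ≤ b → lball L a ⊆ lball L b := fun hab x hx => le_trans hx hab
  have hC0 : 0 ≤ C := by
    have h1 : (0 : ℝ) < (lball L 1).ncard := by
      rw [Nat.cast_pos, Set.ncard_pos (hfin 1)]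
      exact ⟨1, by simp [lball, (hL.eq_zero_iff 1).2 rfl]⟩
    exact nonneg_of_mul_nonneg_left ((Nat.cast_nonneg _).trans (hC 1 le_rfl)) h1
  refine ⟨√(C ^ 4), Real.sqrt_nonneg _, fun r hr => ?_⟩
  set F : Finset G := (hfin r).toFinset with hF
  set E : Finset G := (hfin (13 * r)).toFinset.filter fun g => 2 * r ≤ L g with hE
  have memF : ∀ g, g ∈ F ↔ L g ≤ r := fun g => by simp [hF, lball]
  have memE : ∀ g, g ∈ E ↔ L g ≤ 13 * r ∧ 2 * r ≤ L g := fun g => by simp [hE, lball]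
  have hFne : F.Nonempty := ⟨1, (memF 1).2 (by rw [(hL.eq_zero_iff 1).2 rfl]; linarith)⟩
  have hFpos : (0 : ℝ) < F.card := by exact_mod_cast hFne.card_pos
  have hcard : (E.card : ℝ) ≤ C ^ 4 * F.card := by
    have hFc : (F.card : ℝ) = (lball L r).ncard := by
      rw [Set.ncard_eq_toFinset_card _ (hfin r)]
    have hEc : (E.card : ℝ) ≤ (lball L (2 * (2 * (2 * (2 * r))))).ncard := by
      rw [Set.ncard_eq_toFinset_card _ (hfin _), Nat.cast_le]
      refine Finset.card_le_card fun g hg => ?_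
      have := ((memE g).1 hg).1
      simp only [Set.Finite.mem_toFinset, lball, Set.mem_ofPred_eq]
      linarith
    rw [hFc]
    calc (E.card : ℝ) ≤ (lball L (2 * (2 * (2 * (2 * r))))).ncard := hEc
      _ ≤ C * (lball L (2 * (2 * (2 * r)))).ncard := hC _ (by linarith)
      _ ≤ C * (C * (lball L (2 * (2 * r))).ncard) := by gcongr; exact hC _ (by linarith)
      _ ≤ C * (C * (C * (lball L (2 * r)).ncard)) := by gcongr; exact hC _ (by linarith)
      _ ≤ C * (C * (C * (C * (lball L r).ncard))) := by gcongr; exact hC _ hr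
      _ = _ := by ring
  have hM : √((E.card : ℝ) / F.card) ≤ √(C ^ 4) :=
    Real.sqrt_le_sqrt ((div_le_iff₀ hFpos).2 hcard)
  have hr0 : 0 < r := by linarith
  refine ⟨avgMult E F, fun g h1 h2 => avgMult_eq_one hFne fun v hv => ?_,
    fun g hg => avgMult_eq_zero fun v hv hvg => ?_, fun A c hc hA => ?_, fun f hf => ?_⟩
  · have hv' := (memF v).1 hv
    obtain ⟨h3, h4⟩ := hL.sub_le_mul_inv v g
    exact (memE _).2 ⟨by linarith, by linarith⟩
  · have hv' := (memF v).1 hv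
    obtain ⟨h3, h4⟩ := hL.sub_le_mul_inv v g
    obtain ⟨h5, h6⟩ := (memE _).1 hvg
    rcases hg with hg | hg <;> linarith
  · exact (hA.mul_avgMult_of_bound hc E F hFne).mono (by gcongr)
  · exact (KernelBound.mul_avgMult_of_comm hL hf hr0 E F hFne
      (fun g hg => ((memE g).1 hg).2) (fun g hg => (memF g).1 hg)).mono (by gcongr)

/-- If `m j` is `1` for `3·4ʲ ≤ ℓ ≤ 12·4ʲ` and `0` outside `4ʲ ≤ ℓ ≤ 14·4ʲ`, then the products
`m (j + 1) * (1 - m j)` sum to `1`. -/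
theorem sum_annular_eq_one {m : ℕ → ℂ} {ℓ : ℝ} {J n : ℕ}
    (hone : ∀ j, 3 * (4 : ℝ) ^ j ≤ ℓ → ℓ ≤ 12 * 4 ^ j → m j = 1)
    (hzero : ∀ j, ℓ < 4 ^ j ∨ 14 * (4 : ℝ) ^ j < ℓ → m j = 0)
    (hJ : 3 * (4 : ℝ) ^ (J + 2) ≤ ℓ) (hn : ℓ < 3 * 4 ^ n) :
    ∑ k ∈ Finset.range n, m (J + k + 1) * (1 - m (J + k)) = 1 := by
  obtain ⟨i, hi1, hi2⟩ := exists_nat_pow_near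
    (x := ℓ / (3 * 4 ^ (J + 2))) (y := (4 : ℝ)) ((one_le_div (by positivity)).2 hJ) (by norm_num)
  rw [le_div_iff₀ (by positivity)] at hi1
  rw [div_lt_iff₀ (by positivity)] at hi2
  have hlow : 3 * (4 : ℝ) ^ (J + i + 2) ≤ ℓ := by
    refine le_trans (le_of_eq ?_) hi1; ring
  have hup : ℓ < 12 * (4 : ℝ) ^ (J + i + 2) := by
    refine lt_of_lt_of_eq hi2 ?_; ring
  have hmid : m (J + i + 2) = 1 := hone _ hlow hup.le
  have hbelow : ∀ j, j ≤ J + i → m j = 0 := by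
    intro j hj
    refine hzero j (Or.inr (lt_of_lt_of_le ?_ hlow))
    have : (4 : ℝ) ^ j ≤ 4 ^ (J + i) := pow_le_pow_right₀ (by norm_num) hj
    have h0 : (0 : ℝ) < 4 ^ j := by positivity
    rw [pow_add _ (J + i) 2]
    linarith
  have habove : ∀ j, J + i + 4 ≤ j → m j = 0 := by
    intro j hj
    refine hzero j (Or.inl (lt_of_lt_of_le hup ?_))
    have : (4 : ℝ) ^ (J + i + 4) ≤ 4 ^ j := pow_le_pow_right₀ (by norm_num) hj
    refine le_trans ?_ this
    have h0 : (0 : ℝ) < 4 ^ (J + i + 2) := by positivity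
    rw [show J + i + 4 = J + i + 2 + 2 by ring, pow_add _ (J + i + 2) 2]
    linarith
  have hin : J + i + 2 < n := by
    by_contra hcon
    have : (4 : ℝ) ^ n ≤ 4 ^ (J + i + 2) := pow_le_pow_right₀ (by norm_num) (not_lt.1 hcon)
    linarith
  rw [Finset.sum_eq_add i (i + 1) (by omega)]
  · rw [hbelow (J + i) le_rfl, show J + (i + 1) + 1 = J + i + 2 by ring, hmid,
      show J + (i + 1) = J + i + 1 by ring]
    ring
  · rintro k - ⟨hk1, hk2⟩
    rcases lt_or_gt_of_ne hk1 with hk | hk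
    · rw [hbelow (J + k + 1) (by omega), zero_mul]
    · rcases eq_or_ne k (i + 2) with rfl | hk3
      · rw [show J + (i + 2) = J + i + 2 by ring, hmid, sub_self, mul_zero]
      · rw [habove (J + k + 1) (by omega), zero_mul]
  · intro h
    exact absurd (Finset.mem_range.2 (by omega)) h
  · intro h
    exact absurd (Finset.mem_range.2 (by omega)) h

/-- for every `ε > 0` there is a finite set `S_ε ⊆ G` such that every
finitely supported `f` with `‖[D, λ_f]‖ ≤ 1` decomposes as `f = f♯ + f♭` with
`f♭` supported in `S_ε` and `‖λ_{f♯}‖ ≤ ε`. -/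
theorem exists_decomposition_of_comm_norm_le_one
    (L : G → ℝ) (hL : IsLengthFunction L) (hBD : HasBoundedDoubling L) :
    ∀ ε : ℝ, 0 < ε → ∃ S : Finset G,
      ∀ f : G →₀ ℂ, ∀ Tc : l2 G →L[ℂ] l2 G,
        IsCommOp L (f : G → ℂ) Tc → ‖Tc‖ ≤ 1 →
        ∃ fs fb : G →₀ ℂ, f = fs + fb ∧ (fb.support : Set G) ⊆ (S : Set G) ∧
          ∀ T : l2 G →L[ℂ] l2 G, IsConvOp (fs : G → ℂ) T → ‖T‖ ≤ ε := by
  intro ε hε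
  obtain ⟨M, hM, hm⟩ := exists_annular_multiplier hL hBD
  choose m hone hzero hbdd hgain using fun j : ℕ => hm (4 ^ j) (one_le_pow₀ (by norm_num))
  obtain ⟨J, hJ⟩ := exists_pow_lt_of_lt_one (y := (1 / 4 : ℝ))
    (show 0 < ε / (M * (1 + M) + 1) by positivity) (by norm_num)
  rw [lt_div_iff₀ (by positivity)] at hJ
  refine ⟨(hBD.1 (3 * 4 ^ (J + 2))).toFinset, fun f Tc hTc hnorm => ?_⟩
  have hcomm : KernelBound (fun x y => ((L x : ℂ) - (L y : ℂ)) * f (x * y⁻¹)) 1 :=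
    (kernelBound_of_operator hTc).mono hnorm
  obtain ⟨n, hn⟩ : ∃ n : ℕ, ∀ g ∈ f.support, L g < 3 * 4 ^ n := by
    obtain ⟨K, hK⟩ := (f.support.image L).bddAbove
    obtain ⟨n, hn⟩ := pow_unbounded_of_one_lt K (by norm_num : (1 : ℝ) < 4)
    refine ⟨n, fun g hg => ?_⟩
    have := hK (Finset.mem_coe.2 (Finset.mem_image_of_mem L hg))
    have h0 : (0 : ℝ) < 4 ^ n := by positivity
    linarith
  set w : G → ℂ := fun g => ∑ k ∈ Finset.range n, m (J + k + 1) g * (1 - m (J + k) g) with hw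
  have hwbound : KernelBound (fun x y => f (x * y⁻¹) * w (x * y⁻¹)) ε := by
    have hterm : ∀ k ∈ Finset.range n, KernelBound
        (fun x y => f (x * y⁻¹) * m (J + k + 1) (x * y⁻¹) -
          f (x * y⁻¹) * m (J + k + 1) (x * y⁻¹) * m (J + k) (x * y⁻¹))
        (1 / 4 ^ (J + k + 1) * M + 1 / 4 ^ (J + k + 1) * M * M) := fun k _ =>
      (hgain (J + k + 1) f hcomm).sub
        (hbdd (J + k) _ _ (by positivity) (hgain (J + k + 1) f hcomm))
    have hsum := KernelBound.finsetSum (Finset.range n) hterm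
    have hgeom : ∀ n : ℕ, ∑ k ∈ Finset.range n,
        (1 / 4 ^ (J + k + 1) * M + 1 / 4 ^ (J + k + 1) * M * M) =
        (1 / 4 : ℝ) ^ J * (M * (1 + M)) * ((1 - (1 / 4) ^ n) / 3) := by
      intro n
      induction n with
      | zero => simp
      | succ n ih =>
        rw [Finset.sum_range_succ, ih]
        simp only [one_div, inv_pow, pow_add, pow_one]
        field_simp
        ring
    rw [hgeom] at hsum
    convert hsum.mono (d := ε) ?_ using 3 with x y
    · rw [hw, Finset.mul_sum]
      exact Finset.sum_congr rfl fun k _ => by ring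
    · have h1 : (0 : ℝ) ≤ (1 / 4) ^ n := by positivity
      have h2 : (0 : ℝ) < (1 / 4) ^ J := by positivity
      calc (1 / 4 : ℝ) ^ J * (M * (1 + M)) * ((1 - (1 / 4) ^ n) / 3)
          ≤ (1 / 4 : ℝ) ^ J * (M * (1 + M)) * 1 := by gcongr; linarith
        _ ≤ ε := by nlinarith
  refine ⟨Finsupp.onFinset f.support (fun g => f g * w g) fun g hg => ?_,
    Finsupp.onFinset f.support (fun g => f g * (1 - w g)) fun g hg => ?_, ?_, ?_, ?_⟩
  · exact Finsupp.mem_support_iff.2 (left_ne_zero_of_mul hg)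
  · exact Finsupp.mem_support_iff.2 (left_ne_zero_of_mul hg)
  · ext g
    simp only [Finsupp.add_apply, Finsupp.onFinset_apply]
    ring
  · intro g hg
    have hne : f g * (1 - w g) ≠ 0 := by simpa using hg
    simp only [Set.Finite.coe_toFinset, lball, Set.mem_ofPred_eq]
    by_contra hcon
    have hsum : w g = 1 := sum_annular_eq_one (m := fun j => m j g) (fun j => hone j g)
      (fun j => hzero j g) (not_le.1 hcon).le
      (hn g (Finsupp.mem_support_iff.2 (left_ne_zero_of_mul hne)))
    exact hne (by rw [hsum, sub_self, mul_zero])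
  · intro T hT
    refine IsConvOp.norm_le_of_kernelBound hε.le ?_ hT
    simpa only [Finsupp.onFinset_apply] using hwbound
end
end

section
/- Let G be a discrete group and L a length function on G. For all finitely supported f, h, k : G → ℂ one has J_D((h*∗k)·f) ≤ ‖h‖₂ · ‖k‖₂ · J_D(f), where (h*∗k)·f denotes the pointwise product of the convolution h*∗k with f. -/
open scoped ENNReal ComplexConjugate

noncomputable section

variable {G : Type*}

variable [Group G]

/-- `T` has matrix `a` with respect to the canonical basis of `ℓ²(G)`. -/
def HasMatrix {ι : Type*} (a : ι → ι → ℂ) (T : l2 ι →L[ℂ] l2 ι) : Prop :=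
  ∀ (ξ : l2 ι) (x : ι), T ξ x = ∑' y : ι, a x y * ξ y

/-- The sesquilinear form of the matrix `a` is bounded by `C` on finitely supported vectors. -/
def FormBound {ι : Type*} (a : ι → ι → ℂ) (C : ℝ) : Prop :=
  ∀ (S : Finset ι) (η ξ : ι → ℂ),
    ‖∑ x ∈ S, ∑ y ∈ S, conj (η x) * (a x y * ξ y)‖ ≤
      C * (√(∑ x ∈ S, ‖η x‖ ^ 2) * √(∑ y ∈ S, ‖ξ y‖ ^ 2))

section Matrix

variable {ι : Type*}

theorem l2_norm_sum_single [DecidableEq ι] (S : Finset ι) (ξ : ι → ℂ) :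
    ‖∑ y ∈ S, (lp.single 2 y (ξ y) : l2 ι)‖ = √(∑ y ∈ S, ‖ξ y‖ ^ 2) := by
  have h := lp.norm_sum_single (E := fun _ : ι => ℂ) (p := 2) (by norm_num) ξ S
  simp only [ENNReal.toReal_ofNat, Real.rpow_ofNat] at h
  rw [← h, Real.sqrt_sq (norm_nonneg _)]

theorem l2_sum_single_apply [DecidableEq ι] (S : Finset ι) (ξ : ι → ℂ) (x : ι) :
    (∑ y ∈ S, (lp.single 2 y (ξ y) : l2 ι) : l2 ι) x = if x ∈ S then ξ x else 0 := by
  rw [lp.coeFn_sum, Finset.sum_apply]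
  simp [lp.single_apply, Pi.single_apply]

namespace HasMatrix

variable {a : ι → ι → ℂ} {T T' : l2 ι →L[ℂ] l2 ι}

theorem ext (h : HasMatrix a T) (h' : HasMatrix a T') : T = T' := by
  ext ξ x
  rw [h, h']

theorem inner_sum_single [DecidableEq ι] (h : HasMatrix a T) (S : Finset ι) (η ξ : ι → ℂ) :
    inner ℂ (∑ x ∈ S, (lp.single 2 x (η x) : l2 ι)) (T (∑ y ∈ S, (lp.single 2 y (ξ y) : l2 ι))) =
      ∑ x ∈ S, ∑ y ∈ S, conj (η x) * (a x y * ξ y) := by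
  rw [sum_inner]
  refine Finset.sum_congr rfl fun x _ => ?_
  rw [lp.inner_single_left, h, tsum_eq_sum (s := S), RCLike.inner_apply, mul_comm, Finset.mul_sum]
  · refine Finset.sum_congr rfl fun y hy => ?_
    rw [l2_sum_single_apply, if_pos hy]
  · intro y hy
    rw [l2_sum_single_apply, if_neg hy, mul_zero]

theorem formBound (h : HasMatrix a T) : FormBound a ‖T‖ := by
  classical
  intro S η ξ
  rw [← h.inner_sum_single, ← l2_norm_sum_single, ← l2_norm_sum_single]
  refine (norm_inner_le_norm _ _).trans ?_
  rw [mul_left_comm]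
  exact mul_le_mul_of_nonneg_left (T.le_opNorm _) (norm_nonneg _)

theorem opNorm_le (h : HasMatrix a T) {C : ℝ} (hC : 0 ≤ C) (ha : FormBound a C) : ‖T‖ ≤ C := by
  classical
  have key (η ξ : l2 ι) : ‖inner ℂ η (T ξ)‖ ≤ C * (‖η‖ * ‖ξ‖) := by
    have hη := lp.hasSum_single (p := 2) (by norm_num) η
    have hξ := lp.hasSum_single (p := 2) (by norm_num) ξ
    refine le_of_tendsto_of_tendsto'
      ((Filter.Tendsto.inner hη ((T.continuous.tendsto _).comp hξ)).norm)
      ((hη.norm.mul hξ.norm).const_mul C) fun S => ?_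
    rw [Function.comp_apply, h.inner_sum_single, l2_norm_sum_single, l2_norm_sum_single]
    exact ha S η ξ
  refine T.opNorm_le_bound hC fun ξ => ?_
  have h1 := key (T ξ) ξ
  rw [inner_self_eq_norm_sq_to_K, norm_pow, RCLike.norm_ofReal, abs_norm, sq,
    mul_left_comm] at h1
  rcases (norm_nonneg (T ξ)).eq_or_lt with h0 | h0
  · rw [← h0]
    positivity
  · exact le_of_mul_le_mul_left h1 h0

end HasMatrix

theorem l2norm_nonneg (h : ι → ℂ) : 0 ≤ l2norm h := Real.sqrt_nonneg _

theorem sum_comp_le_l2norm_sq (h : ι →₀ ℂ) (W : Finset ι) {e : ι → ι}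
    (he : Function.Injective e) : ∑ w ∈ W, ‖h (e w)‖ ^ 2 ≤ l2norm (h : ι → ℂ) ^ 2 := by
  rw [l2norm, Real.sq_sqrt (tsum_nonneg fun _ => by positivity),
    show ∑ w ∈ W, ‖h (e w)‖ ^ 2 = ∑ x ∈ W.map ⟨e, he⟩, ‖h x‖ ^ 2 by simp]
  refine Summable.sum_le_tsum _ (fun _ _ => by positivity) ?_
  refine summable_of_ne_finset_zero (s := h.support) fun x hx => ?_
  simp [Finsupp.notMem_support_iff.1 hx]

end Matrix

theorem starConv_mul_inv (h k : G → ℂ) (x y : G) {W : Finset G}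
    (hW : ∀ w ∉ W, h (w⁻¹ * x⁻¹) = 0) :
    starConv h k (x * y⁻¹) = ∑ w ∈ W, conj (h (w⁻¹ * x⁻¹)) * k (w⁻¹ * y⁻¹) := by
  rw [starConv, ← (Equiv.mulLeft x).tsum_eq, tsum_eq_sum (s := W)]
  · simp [mul_assoc]
  · intro w hw
    simp [hW w hw]

theorem sqrt_sum_sum_le (h : G →₀ ℂ) (W S : Finset G) (η : G → ℂ) :
    √(∑ w ∈ W, ∑ x ∈ S, ‖h (w⁻¹ * x⁻¹) * η x‖ ^ 2) ≤
      l2norm (h : G → ℂ) * √(∑ x ∈ S, ‖η x‖ ^ 2) := by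
  rw [← Real.sqrt_sq (l2norm_nonneg (h : G → ℂ)), ← Real.sqrt_mul (sq_nonneg _)]
  refine Real.sqrt_le_sqrt ?_
  rw [Finset.sum_comm, Finset.mul_sum]
  refine Finset.sum_le_sum fun x _ => ?_
  simp only [norm_mul, mul_pow]
  rw [← Finset.sum_mul]
  refine mul_le_mul_of_nonneg_right (sum_comp_le_l2norm_sq h W fun u v huv => ?_) (sq_nonneg _)
  simpa using huv

/-- Multiplying a matrix entrywise by `(h* ∗ k)(xy⁻¹)` multiplies its form bound by at most
`‖h‖₂ ‖k‖₂`. -/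
theorem FormBound.starConv_mul {a : G → G → ℂ} {C : ℝ} (hC : 0 ≤ C) (ha : FormBound a C)
    (h k : G →₀ ℂ) :
    FormBound (fun x y => starConv (h : G → ℂ) (k : G → ℂ) (x * y⁻¹) * a x y)
      (l2norm (h : G → ℂ) * l2norm (k : G → ℂ) * C) := by
  classical
  intro S η ξ
  let W : Finset G := S.biUnion fun x => h.support.image fun s => (s * x)⁻¹
  have hW (x : G) (hx : x ∈ S) (w : G) (hw : w ∉ W) : h (w⁻¹ * x⁻¹) = 0 := by
    by_contra hne
    exact hw (Finset.mem_biUnion.2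
      ⟨x, hx, Finset.mem_image.2 ⟨w⁻¹ * x⁻¹, Finsupp.mem_support_iff.2 hne, by simp⟩⟩)
  have expand : ∑ x ∈ S, ∑ y ∈ S,
      conj (η x) * (starConv (h : G → ℂ) (k : G → ℂ) (x * y⁻¹) * a x y * ξ y) =
      ∑ w ∈ W, ∑ x ∈ S, ∑ y ∈ S,
        conj (h (w⁻¹ * x⁻¹) * η x) * (a x y * (k (w⁻¹ * y⁻¹) * ξ y)) := by
    rw [Finset.sum_comm (s := W)]
    refine Finset.sum_congr rfl fun x hx => ?_
    rw [Finset.sum_comm (s := W)]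
    refine Finset.sum_congr rfl fun y _ => ?_
    rw [starConv_mul_inv _ _ x y (hW x hx), Finset.sum_mul, Finset.sum_mul, Finset.mul_sum]
    refine Finset.sum_congr rfl fun w _ => ?_
    rw [map_mul (starRingEnd ℂ)]
    ring
  rw [expand]
  calc
    _ ≤ ∑ w ∈ W, C * (√(∑ x ∈ S, ‖h (w⁻¹ * x⁻¹) * η x‖ ^ 2) *
          √(∑ y ∈ S, ‖k (w⁻¹ * y⁻¹) * ξ y‖ ^ 2)) :=
      norm_sum_le_of_le _ fun w _ => ha S _ _
    _ ≤ C * (√(∑ w ∈ W, ∑ x ∈ S, ‖h (w⁻¹ * x⁻¹) * η x‖ ^ 2) *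
          √(∑ w ∈ W, ∑ y ∈ S, ‖k (w⁻¹ * y⁻¹) * ξ y‖ ^ 2)) := by
      rw [← Finset.mul_sum]
      exact mul_le_mul_of_nonneg_left (Real.sum_sqrt_mul_sqrt_le W
        (fun _ => by positivity) (fun _ => by positivity)) hC
    _ ≤ C * ((l2norm (h : G → ℂ) * √(∑ x ∈ S, ‖η x‖ ^ 2)) *
          (l2norm (k : G → ℂ) * √(∑ y ∈ S, ‖ξ y‖ ^ 2))) := by
      refine mul_le_mul_of_nonneg_left (mul_le_mul (sqrt_sum_sum_le h W S η)
        (sqrt_sum_sum_le k W S ξ) (Real.sqrt_nonneg _) ?_) hC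
      exact mul_nonneg (l2norm_nonneg _) (Real.sqrt_nonneg _)
    _ = _ := by ring

/-- The matrix of the truncated operator `(I − M_{2r}) λ_f M_r`. -/
def truncMatrix (L : G → ℝ) (f : G → ℂ) (r : ℝ) (x y : G) : ℂ :=
  if L x ≤ 2 * r then 0 else if L y ≤ r then f (x * y⁻¹) else 0

theorem isTruncOp_iff_hasMatrix {L : G → ℝ} {f : G → ℂ} {r : ℝ} {T : l2 G →L[ℂ] l2 G} :
    IsTruncOp L f r T ↔ HasMatrix (truncMatrix L f r) T := by
  refine forall₂_congr fun ξ x => ?_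
  simp only [truncMatrix]
  split_ifs <;> simp [ite_mul]

theorem truncMatrix_mul (L : G → ℝ) (φ f : G → ℂ) (r : ℝ) :
    truncMatrix L (fun x => φ x * f x) r =
      fun x y => φ (x * y⁻¹) * truncMatrix L f r x y := by
  ext x y
  simp only [truncMatrix]
  split_ifs <;> simp

/-- Left translation by `g` on `ℓ²(G)` followed by the coordinate projection onto `p`. -/
theorem exists_cutoff_translation (g : G) (p : G → Prop) [DecidablePred p] :
    ∃ U : l2 G →L[ℂ] l2 G, ‖U‖ ≤ 1 ∧
      ∀ (ξ : l2 G) (x : G), U ξ x = if p x then ξ (g⁻¹ * x) else 0 := by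
  have h2 : 0 < (2 : ℝ≥0∞).toReal := by norm_num
  have hle (ξ : l2 G) (x : G) : ‖(if p x then ξ (g⁻¹ * x) else 0 : ℂ)‖ ^ (2 : ℝ≥0∞).toReal ≤
      ‖ξ (g⁻¹ * x)‖ ^ (2 : ℝ≥0∞).toReal := by
    refine Real.rpow_le_rpow (norm_nonneg _) ?_ h2.le
    split_ifs <;> simp
  have hsum (ξ : l2 G) : Summable fun x => ‖ξ (g⁻¹ * x)‖ ^ (2 : ℝ≥0∞).toReal :=
    (Equiv.mulLeft g⁻¹).summable_iff.2 ((lp.memℓp ξ).summable h2)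
  have hmem (ξ : l2 G) : Memℓp (fun x => (if p x then ξ (g⁻¹ * x) else 0 : ℂ)) 2 :=
    memℓp_gen ((hsum ξ).of_nonneg_of_le (fun _ => by positivity) (hle ξ))
  let U : l2 G →ₗ[ℂ] l2 G :=
    { toFun := fun ξ => ⟨_, hmem ξ⟩
      map_add' := fun ξ η => by
        ext x
        change (if p x then (ξ + η) (g⁻¹ * x) else 0 : ℂ) =
          (if p x then ξ (g⁻¹ * x) else 0) + (if p x then η (g⁻¹ * x) else 0)
        split_ifs <;> simp
      map_smul' := fun c ξ => by
        ext x
        change (if p x then (c • ξ) (g⁻¹ * x) else 0 : ℂ) =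
          c • (if p x then ξ (g⁻¹ * x) else 0)
        split_ifs <;> simp }
  have hU (ξ : l2 G) : ‖U ξ‖ ≤ 1 * ‖ξ‖ := by
    rw [one_mul]
    refine lp.norm_le_of_forall_sum_le h2 (norm_nonneg _) fun S => ?_
    calc
      _ ≤ ∑ x ∈ S, ‖ξ (g⁻¹ * x)‖ ^ (2 : ℝ≥0∞).toReal := Finset.sum_le_sum fun x _ => hle ξ x
      _ ≤ ∑' x, ‖ξ (g⁻¹ * x)‖ ^ (2 : ℝ≥0∞).toReal :=
        (hsum ξ).sum_le_tsum S fun _ _ => by positivity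
      _ = ∑' x, ‖ξ x‖ ^ (2 : ℝ≥0∞).toReal :=
        (Equiv.mulLeft g⁻¹).tsum_eq fun x => ‖ξ x‖ ^ (2 : ℝ≥0∞).toReal
      _ = _ := (lp.norm_rpow_eq_tsum h2 ξ).symm
  exact ⟨U.mkContinuous 1 hU, U.mkContinuous_norm_le zero_le_one hU, fun _ _ => rfl⟩

theorem exists_isTruncOp (L : G → ℝ) (f : G →₀ ℂ) (r : ℝ) :
    ∃ T : l2 G →L[ℂ] l2 G, IsTruncOp L f r T ∧ ‖T‖ ≤ ∑ g ∈ f.support, ‖f g‖ := by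
  classical
  choose U hU hUapply using fun g : G =>
    exists_cutoff_translation g fun x => ¬ L x ≤ 2 * r ∧ L (g⁻¹ * x) ≤ r
  refine ⟨∑ g ∈ f.support, f g • U g, fun ξ x => ?_, ?_⟩
  · have hx : (∑ g ∈ f.support, f g • U g) ξ x = ∑ g ∈ f.support, f g * U g ξ x := by
      rw [sum_apply, lp.coeFn_sum, Finset.sum_apply]
      simp
    rw [hx]
    simp only [hUapply]
    split_ifs with hLx
    · simp [hLx.not_gt]
    · rw [← ((Equiv.inv G).trans (Equiv.mulRight x)).tsum_eq, tsum_eq_sum (s := f.support)]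
      · refine Finset.sum_congr rfl fun g _ => ?_
        simp [hLx]
      · intro g hg
        simp [Finsupp.notMem_support_iff.1 hg]
  · refine norm_sum_le_of_le _ fun g _ => ?_
    rw [norm_smul]
    exact mul_le_of_le_one_right (norm_nonneg _) (hU g)

theorem truncMatrix_eq_zero {L : G → ℝ} (hL : IsLengthFunction L) {f : G → ℂ} {r : ℝ}
    (hr : ∀ g, f g ≠ 0 → L g ≤ r) (x y : G) : truncMatrix L f r x y = 0 := by
  rw [truncMatrix]
  split_ifs with hx hy
  · rfl
  · by_contra hne
    have h1 := hL.subadd (x * y⁻¹) y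
    rw [inv_mul_cancel_right] at h1
    linarith [hr _ hne]
  · rfl

theorem JD_nonneg (L : G → ℝ) (f : G → ℂ) : 0 ≤ JD L f := by
  refine Real.sSup_nonneg ?_
  rintro _ ⟨r, hr, T, -, rfl⟩
  positivity

theorem mul_norm_le_JD {L : G → ℝ} (hL : IsLengthFunction L) (f : G →₀ ℂ) {r : ℝ} (hr : 0 < r)
    {T : l2 G →L[ℂ] l2 G} (hT : IsTruncOp L f r T) : r * ‖T‖ ≤ JD L (f : G → ℂ) := by
  refine le_csSup ⟨(∑ g ∈ f.support, L g) * ∑ g ∈ f.support, ‖f g‖, ?_⟩ ⟨r, hr, T, hT, rfl⟩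
  rintro _ ⟨s, hs, T', hT', rfl⟩
  have hR : 0 ≤ ∑ g ∈ f.support, L g := Finset.sum_nonneg fun g _ => hL.nonneg g
  rw [isTruncOp_iff_hasMatrix] at hT'
  rcases le_total (∑ g ∈ f.support, L g) s with h | h
  · have hzero : T' = 0 := hT'.ext fun ξ x => by
      have hs' : ∀ g, f g ≠ 0 → L g ≤ s := fun g hg =>
        (Finset.single_le_sum (fun g _ => hL.nonneg g) (Finsupp.mem_support_iff.2 hg)).trans h
      simp [truncMatrix_eq_zero hL hs']
    rw [hzero, norm_zero, mul_zero]
    positivity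
  · obtain ⟨T₀, hT₀, hle⟩ := exists_isTruncOp L f s
    rw [hT'.ext (isTruncOp_iff_hasMatrix.1 hT₀)]
    exact mul_le_mul h hle (norm_nonneg _) hR

/-- `J_D((h*∗k)·f) ≤ ‖h‖₂ ‖k‖₂ J_D(f)`. -/
theorem JD_conv_cutoff_le
    (L : G → ℝ) (hL : IsLengthFunction L) (f h k : G →₀ ℂ) :
    JD L (fun x => starConv (h : G → ℂ) (k : G → ℂ) x * f x) ≤
      l2norm (h : G → ℂ) * l2norm (k : G → ℂ) * JD L (f : G → ℂ) := by
  have hhk : 0 ≤ l2norm (h : G → ℂ) * l2norm (k : G → ℂ) :=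
    mul_nonneg (l2norm_nonneg _) (l2norm_nonneg _)
  refine Real.sSup_le ?_ (mul_nonneg hhk (JD_nonneg L f))
  rintro _ ⟨r, hr, T, hT, rfl⟩
  obtain ⟨T₀, hT₀, -⟩ := exists_isTruncOp L f r
  rw [isTruncOp_iff_hasMatrix, truncMatrix_mul] at hT
  have hle := hT.opNorm_le (mul_nonneg hhk (norm_nonneg T₀))
    ((isTruncOp_iff_hasMatrix.1 hT₀).formBound.starConv_mul (norm_nonneg _) h k)
  calc
    r * ‖T‖ ≤ r * (l2norm (h : G → ℂ) * l2norm (k : G → ℂ) * ‖T₀‖) :=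
      mul_le_mul_of_nonneg_left hle hr.le
    _ = l2norm (h : G → ℂ) * l2norm (k : G → ℂ) * (r * ‖T₀‖) := by ring
    _ ≤ _ := mul_le_mul_of_nonneg_left (mul_norm_le_JD hL f hr hT₀) hhk
end
end
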